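/- Let M be a finite multiset over the positive integers of size n ≥ 1, and write the polynomial Σ_{w a Smirnov word on M} t^{des(w)} as Σ_{j=0}^{n−1} b_j t^j. Then b_j = b_{n−1−j} for all 0 ≤ j ≤ n−1, and the coefficient sequence is unimodal: b_0 ≤ b_1 ≤ ⋯ ≤ b_{⌊(n−1)/2⌋}. -/

import Mathlib

attribute [local instance] Classical.propDecidable

open Polynomial

/-- The number of ascents of the word `w = w₁ ⋯ w_m`:
indices `i ∈ [m-1]` with `w_i ≤ w_{i+1}`. -/
noncomputable def ascF {m : ℕ} (w : Fin m → ℕ) : ℕ :=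
  (Finset.univ.filter fun i : Fin (m - 1) =>
      w ⟨(i : ℕ), by have := i.2; omega⟩ ≤ w ⟨(i : ℕ) + 1, by have := i.2; omega⟩).card

/-- The number of descents of the word `w = w₁ ⋯ w_m`:
indices `i ∈ [m-1]` with `w_i > w_{i+1}`. -/
noncomputable def desF {m : ℕ} (w : Fin m → ℕ) : ℕ :=
  (Finset.univ.filter fun i : Fin (m - 1) =>
      w ⟨(i : ℕ) + 1, by have := i.2; omega⟩ < w ⟨(i : ℕ), by have := i.2; omega⟩).card

/-- The word `w = w₁ ⋯ w_m` has no double ascent (no `i` with `w_i ≤ w_{i+1} ≤ w_{i+2}`). -/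
def NDAF {m : ℕ} (w : Fin m → ℕ) : Prop :=
  ∀ i : ℕ, ∀ h : i + 2 < m,
    ¬(w ⟨i, by omega⟩ ≤ w ⟨i + 1, by omega⟩ ∧ w ⟨i + 1, by omega⟩ ≤ w ⟨i + 2, h⟩)

/-- The word `w = w₁ ⋯ w_m` has no double descent (no `i` with `w_i > w_{i+1} > w_{i+2}`). -/
def NDDF {m : ℕ} (w : Fin m → ℕ) : Prop :=
  ∀ i : ℕ, ∀ h : i + 2 < m,
    ¬(w ⟨i + 1, by omega⟩ < w ⟨i, by omega⟩ ∧ w ⟨i + 2, h⟩ < w ⟨i + 1, by omega⟩)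

/-- The multiset permutations of the multiset encoded by its weakly increasing
arrangement `u`: all rearrangements `u ∘ σ` of `u`. -/
noncomputable def msPerms {n : ℕ} (u : Fin n → ℕ) : Finset (Fin n → ℕ) :=
  Finset.image (fun σ : Equiv.Perm (Fin n) => u ∘ σ) Finset.univ

/-- The number of excedances of the multiset permutation with top row `u` (weakly
increasing) and bottom row `w`: columns `j` with `w_j > u_j`. -/
noncomputable def excW {n : ℕ} (u w : Fin n → ℕ) : ℕ :=
  (Finset.univ.filter fun j : Fin n => u j < w j).card

/-- `w` is a Smirnov word: it has no two equal adjacent letters. -/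
def IsSmirnov {m : ℕ} (w : Fin m → ℕ) : Prop :=
  ∀ i : ℕ, ∀ h : i + 1 < m, w ⟨i, by omega⟩ ≠ w ⟨i + 1, h⟩


noncomputable def cz (f : ℤ[X]) (a : ℤ) : ℤ := if 0 ≤ a then f.coeff a.toNat else 0

lemma cz_add (f g : ℤ[X]) (a : ℤ) : cz (f + g) a = cz f a + cz g a := by
  unfold cz; split_ifs <;> simp

lemma cz_zero (a : ℤ) : cz 0 a = 0 := by simp [cz]

lemma cz_X_mul (f : ℤ[X]) (a : ℤ) : cz (X * f) a = cz f (a - 1) := by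
  unfold cz
  rcases lt_trichotomy a 0 with h | h | h
  · rw [if_neg (by omega), if_neg (by omega)]
  · subst h; simp
  · obtain ⟨k, rfl⟩ : ∃ k : ℕ, a = (k : ℤ) + 1 := ⟨(a - 1).toNat, by omega⟩
    rw [if_pos (by omega), if_pos (by omega)]
    have h1 : ((k : ℤ) + 1).toNat = k + 1 := by omega
    rw [h1, coeff_X_mul]; simp

/-- symmetric (about `d/2`) and unimodal -/
def SU (d : ℤ) (f : ℤ[X]) : Prop :=
  (∀ a, cz f (d - a) = cz f a) ∧ ∀ a, 2 * (a + 1) ≤ d → cz f a ≤ cz f (a + 1)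

lemma SU_zero (d : ℤ) : SU d 0 := ⟨fun a => by simp [cz_zero], fun a _ => by simp [cz_zero]⟩

lemma SU_add {d : ℤ} {f g : ℤ[X]} (hf : SU d f) (hg : SU d g) : SU d (f + g) := by
  refine ⟨fun a => ?_, fun a h => ?_⟩
  · rw [cz_add, cz_add, hf.1, hg.1]
  · rw [cz_add, cz_add]; exact add_le_add (hf.2 a h) (hg.2 a h)

lemma SU_X {d : ℤ} {f : ℤ[X]} (hf : SU d f) : SU (d + 2) (X * f) := by
  refine ⟨fun a => ?_, fun a h => ?_⟩
  · rw [cz_X_mul, cz_X_mul, ← hf.1 (a - 1)]; congr 1; ring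
  · rw [cz_X_mul, cz_X_mul]
    have := hf.2 (a - 1) (by omega)
    convert this using 2; ring

/-- q-integer -/
noncomputable def qi (k : ℕ) : ℤ[X] := ∑ l ∈ Finset.range k, X ^ l

lemma cz_qi_mul (f : ℤ[X]) (k : ℕ) (a : ℤ) :
    cz (qi k * f) a = ∑ l ∈ Finset.range k, cz f (a - l) := by
  induction k generalizing a with
  | zero => simp [qi, cz_zero]
  | succ k ih =>
    have : qi (k + 1) = 1 + X * qi k := by
      unfold qi
      rw [Finset.sum_range_succ', Finset.mul_sum]
      simp [pow_succ', add_comm]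
    rw [this, add_mul, one_mul, cz_add, mul_assoc, cz_X_mul, ih, Finset.sum_range_succ']
    rw [add_comm]
    congr 1
    · apply Finset.sum_congr rfl; intro l _; congr 1; push_cast; ring
    · simp

lemma SU_mono {d : ℤ} {f : ℤ[X]} (hf : SU d f) (a : ℤ) (k : ℕ) (h : 2 * (a + k) ≤ d) :
    cz f a ≤ cz f (a + k) := by
  induction k with
  | zero => simp
  | succ k ih =>
    refine (ih (by push_cast at h; omega)).trans ?_
    have := hf.2 (a + k) (by push_cast at h; omega)
    rw [show a + ((k + 1 : ℕ) : ℤ) = a + k + 1 by push_cast; ring]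
    exact this

lemma SU_qi {d : ℤ} {f : ℤ[X]} (hf : SU d f) (k : ℕ) : SU (d + k - 1) (qi k * f) := by
  refine ⟨fun a => ?_, fun a h => ?_⟩
  · rw [cz_qi_mul, cz_qi_mul, ← Finset.sum_range_reflect]
    apply Finset.sum_congr rfl
    intro l hl
    rw [Finset.mem_range] at hl
    rw [← hf.1 (a - l)]
    congr 1
    push_cast [Nat.sub_sub, Nat.cast_sub (show 1 + l ≤ k by omega)]
    ring
  · rw [cz_qi_mul, cz_qi_mul]
    have key : cz f (a + 1 - k) ≤ cz f (a + 1) := by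
      by_cases h2 : 2 * (a + 1) ≤ d
      · have := SU_mono hf (a + 1 - k) k (by omega)
        simpa using this
      · rw [← hf.1 (a + 1)]
        have := SU_mono hf (a + 1 - k) (d - (a + 1) - (a + 1 - k)).toNat (by omega)
        convert this using 2
        omega
    have e1 := Finset.sum_range_succ (fun l : ℕ => cz f (a + 1 - l)) k
    have e2 := Finset.sum_range_succ' (fun l : ℕ => cz f (a + 1 - l)) k
    have e3 : ∑ l ∈ Finset.range k, cz f (a + 1 - ((l + 1 : ℕ) : ℤ)) = ∑ l ∈ Finset.range k, cz f (a - l) := by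
      apply Finset.sum_congr rfl; intro l _; congr 1; push_cast; ring
    simp only [Nat.cast_zero, sub_zero] at e2
    linarith

abbrev AA := MvPolynomial ℕ ℤ[X]

def KK (d : ℤ) (f : AA) : Prop := ∀ m, SU d (f.coeff m)

lemma KK_zero (d : ℤ) : KK d 0 := fun m => by simpa using SU_zero d
lemma KK_add {d : ℤ} {f g : AA} (hf : KK d f) (hg : KK d g) : KK d (f + g) := fun m => by
  simpa using SU_add (hf m) (hg m)
lemma KK_sum {d : ℤ} {ι : Type*} (s : Finset ι) (f : ι → AA) (h : ∀ i ∈ s, KK d (f i)) :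
    KK d (∑ i ∈ s, f i) :=
  Finset.sum_induction f (KK d) (fun _ _ => KK_add) (KK_zero d) h
lemma KK_X {d : ℤ} {f : AA} (hf : KK d f) : KK (d + 2) (MvPolynomial.C X * f) := fun m => by
  rw [MvPolynomial.coeff_C_mul]; exact SU_X (hf m)
lemma KK_qi {d : ℤ} {f : AA} (hf : KK d f) (k : ℕ) :
    KK (d + k - 1) (MvPolynomial.C (qi k) * f) := fun m => by
  rw [MvPolynomial.coeff_C_mul]; exact SU_qi (hf m) k

/-- multipliers preserving all the cones -/
def TT : Subsemiring AA where
  carrier := {f | ∀ d g, KK d g → KK d (f * g)}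
  mul_mem' := by
    intro a b ha hb d g hg
    rw [mul_assoc]; exact ha _ _ (hb _ _ hg)
  one_mem' := by intro d g hg; simpa using hg
  add_mem' := by
    intro a b ha hb d g hg
    rw [add_mul]; exact KK_add (ha _ _ hg) (hb _ _ hg)
  zero_mem' := by intro d g _; simpa using KK_zero d

lemma X_mem_TT (a : ℕ) : (MvPolynomial.X a : AA) ∈ TT := by
  intro d g hg m
  rw [MvPolynomial.coeff_X_mul']
  split_ifs
  · exact hg _
  · exact SU_zero d

noncomputable def xz (a : ℕ) : PowerSeries AA := PowerSeries.C (MvPolynomial.X a) * PowerSeries.X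
noncomputable def tt : PowerSeries AA := PowerSeries.C (MvPolynomial.C X)

noncomputable def EE (N : ℕ) : PowerSeries AA := ∏ a ∈ Finset.range N, (1 + xz a)

lemma EE_mem (N i : ℕ) : PowerSeries.coeff i (EE N) ∈ TT := by
  have : ∀ i, PowerSeries.coeff i (EE N) ∈ TT := by
    unfold EE
    refine Finset.prod_induction _ (fun f : PowerSeries AA => ∀ i, PowerSeries.coeff i f ∈ TT) ?_ ?_ ?_
    · intro f g hf hg i
      rw [PowerSeries.coeff_mul]
      exact sum_mem fun p _ => mul_mem (hf _) (hg _)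
    · intro i
      rw [PowerSeries.coeff_one]; split_ifs
      · exact one_mem _
      · exact zero_mem _
    · intro a _ i
      rw [map_add, PowerSeries.coeff_one, xz, PowerSeries.coeff_C_mul, PowerSeries.coeff_X]
      refine add_mem ?_ (mul_mem (X_mem_TT a) ?_) <;> split_ifs <;> first | exact one_mem _ | exact zero_mem _
  exact this i

noncomputable def wt (a b : ℕ) : ℤ[X] := if b < a then X else if a < b then 1 else 0

/-- weighted sum of Smirnov words of length `n` starting with `a` -/
noncomputable def Wc (N : ℕ) : ℕ → ℕ → AA
  | 0, _ => 0
  | 1, a => MvPolynomial.X a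
  | n + 2, a => MvPolynomial.X a * ∑ b ∈ Finset.range N, MvPolynomial.C (wt a b) * Wc N (n + 1) b

noncomputable def Wa (N a : ℕ) : PowerSeries AA := PowerSeries.mk fun n => Wc N n a

lemma Wa_eq (N a : ℕ) : Wa N a = xz a * (1 + ∑ b ∈ Finset.range N, PowerSeries.C (MvPolynomial.C (wt a b)) * Wa N b) := by
  ext1 n
  rw [xz, mul_assoc, PowerSeries.coeff_C_mul, Wa, PowerSeries.coeff_mk]
  match n with
  | 0 => simp [Wc]
  | 1 => simp [Wc, PowerSeries.coeff_succ_X_mul, Wa]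
  | n + 2 =>
    rw [PowerSeries.coeff_succ_X_mul, map_add, map_sum, PowerSeries.coeff_one]
    simp [Wc, Wa, PowerSeries.coeff_C_mul]

noncomputable def PP (N k : ℕ) : PowerSeries AA :=
  1 + ∑ b ∈ Finset.range N, (if b < k then tt else 1) * Wa N b

lemma PP_step (N k : ℕ) (hk : k < N) : (1 + xz k) * PP N (k + 1) = (1 + tt * xz k) * PP N k := by
  have h1 : PP N (k + 1) = PP N k + (tt - 1) * Wa N k := by
    unfold PP
    rw [add_assoc]; congr 1
    rw [← sub_eq_iff_eq_add', ← Finset.sum_sub_distrib,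
      Finset.sum_eq_single_of_mem k (Finset.mem_range.2 hk)]
    · simp; ring
    · intro b _ hb
      have : b < k + 1 ↔ b < k := by omega
      simp [this]
  have h2 : PP N k = (1 + ∑ b ∈ Finset.range N, PowerSeries.C (MvPolynomial.C (wt k b)) * Wa N b) + Wa N k := by
    unfold PP
    rw [add_assoc]; congr 1
    rw [← sub_eq_iff_eq_add', ← Finset.sum_sub_distrib,
      Finset.sum_eq_single_of_mem k (Finset.mem_range.2 hk)]
    · simp [wt]
    · intro b _ hb
      rcases lt_or_gt_of_ne hb with h | h
      · simp [wt, h, tt]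
      · simp [wt, h, not_lt.2 h.le]
  have h3 : Wa N k = xz k * (PP N k - Wa N k) := by
    conv_lhs => rw [Wa_eq]
    rw [h2]; ring
  rw [h1]
  linear_combination (tt - 1) * h3

lemma PP_prod (N k : ℕ) (hk : k ≤ N) :
    (∏ a ∈ Finset.range k, (1 + xz a)) * PP N k = (∏ a ∈ Finset.range k, (1 + tt * xz a)) * PP N 0 := by
  induction k with
  | zero => simp
  | succ k ih =>
    rw [Finset.prod_range_succ, Finset.prod_range_succ, mul_assoc, PP_step N k (by omega)]
    linear_combination (1 + tt * xz k) * ih (by omega)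

noncomputable def Wt (N n : ℕ) : AA := ∑ a ∈ Finset.range N, Wc N n a

lemma Wt_rec (N n : ℕ) : (PowerSeries.coeff n (EE N)) +
    ∑ p ∈ Finset.HasAntidiagonal.antidiagonal n, PowerSeries.coeff p.1 (EE N) * (MvPolynomial.C X * Wt N p.2) =
    MvPolynomial.C X ^ n * (PowerSeries.coeff n (EE N)) +
    ∑ p ∈ Finset.HasAntidiagonal.antidiagonal n, MvPolynomial.C X ^ p.1 * PowerSeries.coeff p.1 (EE N) * Wt N p.2 := by
  have h := PP_prod N N le_rfl
  have e1 : PP N N = 1 + tt * PowerSeries.mk (Wt N) := by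
    unfold PP; congr 1
    rw [show PowerSeries.mk (Wt N) = ∑ b ∈ Finset.range N, Wa N b by ext1 n; simp [Wt, Wa], Finset.mul_sum]
    apply Finset.sum_congr rfl
    intro b hb; rw [if_pos (Finset.mem_range.1 hb)]
  have e2 : PP N 0 = 1 + PowerSeries.mk (Wt N) := by
    unfold PP; congr 1
    rw [show PowerSeries.mk (Wt N) = ∑ b ∈ Finset.range N, Wa N b by ext1 n; simp [Wt, Wa]]
    simp
  have e3 : (∏ a ∈ Finset.range N, (1 + tt * xz a)) = PowerSeries.rescale (MvPolynomial.C X) (EE N) := by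
    rw [EE, map_prod]
    apply Finset.prod_congr rfl
    intro a _
    ext1 n
    rw [PowerSeries.coeff_rescale, map_add, map_add, xz, tt, PowerSeries.coeff_C_mul,
      PowerSeries.coeff_C_mul, PowerSeries.coeff_one, PowerSeries.coeff_X]
    rcases n with _ | _ | n <;> simp
  change EE N * _ = _ at h
  rw [e1, e2, e3] at h
  have := congrArg (PowerSeries.coeff n) h
  rw [mul_add, mul_add, mul_one, mul_one, map_add, map_add, PowerSeries.coeff_mul, PowerSeries.coeff_mul] at this
  simpa only [PowerSeries.coeff_rescale, tt, PowerSeries.coeff_C_mul, PowerSeries.coeff_mk] using this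

lemma qi_mul (k : ℕ) : (1 - X) * qi k = 1 - X ^ k := by
  unfold qi; rw [mul_comm, geom_sum_mul_neg]

lemma Wt_rec2 (N n : ℕ) : Wt N n = MvPolynomial.C (qi n) * PowerSeries.coeff n (EE N) +
    ∑ i ∈ Finset.range n, PowerSeries.coeff (i + 1) (EE N) *
      (MvPolynomial.C X * (MvPolynomial.C (qi i) * Wt N (n - (i + 1)))) := by
  have h := Wt_rec N n
  rw [Finset.Nat.sum_antidiagonal_eq_sum_range_succ_mk, Finset.Nat.sum_antidiagonal_eq_sum_range_succ_mk,
    Finset.sum_range_succ', Finset.sum_range_succ'] at h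
  have hE : PowerSeries.coeff 0 (EE N) = 1 := by
    rw [PowerSeries.coeff_zero_eq_constantCoeff_apply, EE, map_prod]
    simp [xz]
  have hne : (MvPolynomial.C (1 - X) : AA) ≠ 0 := by
    rw [Ne, MvPolynomial.C_eq_zero]
    intro hh
    have := congrArg (Polynomial.coeff · 0) hh
    simp at this
  apply mul_left_cancel₀ hne
  rw [mul_add, ← mul_assoc, ← map_mul, qi_mul, Finset.mul_sum]
  have e : ∀ i ∈ Finset.range n, MvPolynomial.C (1 - X) * (PowerSeries.coeff (i + 1) (EE N) *
      (MvPolynomial.C X * (MvPolynomial.C (qi i) * Wt N (n - (i + 1))))) =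
      PowerSeries.coeff (i + 1) (EE N) * (MvPolynomial.C X * Wt N (n - (i + 1))) -
      MvPolynomial.C X ^ (i + 1) * PowerSeries.coeff (i + 1) (EE N) * Wt N (n - (i + 1)) := by
    intro i _
    have h := congrArg (MvPolynomial.C (σ := ℕ)) (qi_mul i)
    simp only [map_mul, map_sub, map_pow, map_one] at h ⊢
    linear_combination (PowerSeries.coeff (i + 1) (EE N) * MvPolynomial.C X * Wt N (n - (i + 1))) * h
  rw [Finset.sum_congr rfl e, Finset.sum_sub_distrib]
  simp only [map_sub, map_one, map_pow, hE, pow_zero, Nat.sub_zero] at h ⊢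
  linear_combination -h

lemma Wt_KK (N n : ℕ) : KK (n - 1) (Wt N n) := by
  induction n using Nat.strong_induction_on with
  | _ n ih =>
    rw [Wt_rec2]
    apply KK_add
    · have h1 : KK 0 1 := by
        intro m
        rw [MvPolynomial.coeff_one]
        split_ifs
        · refine ⟨fun a => ?_, fun a h => ?_⟩
          · unfold cz; simp only [coeff_one]; split_ifs <;> first | rfl | omega
          · have : cz 1 a = 0 := by rw [cz, if_neg (by omega)]
            rw [this, cz]; simp only [coeff_one]; split_ifs <;> simp
        · exact SU_zero 0
      have := EE_mem N n _ _ (KK_qi h1 n)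
      simpa [mul_comm] using this
    · apply KK_sum
      intro i hi
      rw [Finset.mem_range] at hi
      apply EE_mem
      have := KK_X (KK_qi (ih (n - (i + 1)) (by omega)) i)
      convert this using 1
      push_cast [Nat.cast_sub (show i + 1 ≤ n by omega)]
      ring

noncomputable def wtp {n : ℕ} (w : Fin n → ℕ) : ℤ[X] := if IsSmirnov w then X ^ desF w else 0

noncomputable def TW {n : ℕ} (w : Fin n → ℕ) : AA :=
  (∏ i, MvPolynomial.X (w i)) * MvPolynomial.C (wtp w)

lemma smirnov_cons {n : ℕ} (a : ℕ) (w : Fin (n + 1) → ℕ) :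
    IsSmirnov (Fin.cons a w : Fin (n + 2) → ℕ) ↔ a ≠ w 0 ∧ IsSmirnov w := by
  constructor
  · intro h
    have h0 : (Fin.cons a w : Fin (n + 2) → ℕ) 0 ≠ (Fin.cons a w : Fin (n + 2) → ℕ) (Fin.succ 0) :=
      h 0 (by omega)
    refine ⟨h0, fun i hi => h (i + 1) (by omega)⟩
  · rintro ⟨h0, h⟩ i hi
    rcases i with _ | i
    · exact h0
    · exact h i (by omega)

lemma desF_cons {n : ℕ} (a : ℕ) (w : Fin (n + 1) → ℕ) :
    desF (Fin.cons a w : Fin (n + 2) → ℕ) = (if w 0 < a then 1 else 0) + desF w := by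
  unfold desF
  rw [Finset.card_filter, Finset.card_filter]
  change ∑ i : Fin (n + 1), _ = _ + ∑ i : Fin n, _
  rw [Fin.sum_univ_succ]
  rfl

lemma wtp_cons {n : ℕ} (a : ℕ) (w : Fin (n + 1) → ℕ) :
    wtp (Fin.cons a w : Fin (n + 2) → ℕ) = wt a (w 0) * wtp w := by
  unfold wtp wt
  rw [desF_cons]
  simp only [smirnov_cons]
  rcases lt_trichotomy a (w 0) with h | h | h
  · by_cases hs : IsSmirnov w <;> simp [hs, h, h.ne, not_lt.2 h.le]
  · simp [h]
  · by_cases hs : IsSmirnov w <;> simp [hs, h, h.ne', pow_add]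

lemma TW_cons {n : ℕ} (a : ℕ) (w : Fin (n + 1) → ℕ) :
    TW (Fin.cons a w : Fin (n + 2) → ℕ) =
      MvPolynomial.X a * (MvPolynomial.C (wt a (w 0)) * TW w) := by
  unfold TW
  rw [wtp_cons, Fin.prod_univ_succ, map_mul]
  simp only [Fin.cons_zero, Fin.cons_succ]
  ring

lemma sum_words {M : Type*} [AddCommMonoid M] (N n : ℕ) (F : (Fin (n + 1) → ℕ) → M) :
    ∑ w : Fin (n + 1) → Fin N, F (fun i => (w i : ℕ)) =
      ∑ b ∈ Finset.range N, ∑ w : Fin n → Fin N, F (Fin.cons b (fun i => (w i : ℕ))) := by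
  rw [Finset.sum_range (fun b => ∑ w : Fin n → Fin N, F (Fin.cons b (fun i => (w i : ℕ)))),
    ← (Fin.consEquiv (fun _ => Fin N)).sum_comp, Fintype.sum_prod_type]
  refine Finset.sum_congr rfl fun b _ => Finset.sum_congr rfl fun w _ => ?_
  congr 1
  funext i
  refine Fin.cases ?_ (fun i => ?_) i <;> simp [Fin.consEquiv]

lemma Wc_eq (N n a : ℕ) :
    Wc N (n + 1) a = ∑ w : Fin n → Fin N, TW (Fin.cons a (fun i => (w i : ℕ)) : Fin (n + 1) → ℕ) := by
  induction n generalizing a with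
  | zero =>
    rw [Fintype.sum_unique]
    have h1 : wtp (Fin.cons a (fun i => ((default : Fin 0 → Fin N) i : ℕ)) : Fin 1 → ℕ) = 1 := by
      unfold wtp
      have hs : IsSmirnov (Fin.cons a (fun i => ((default : Fin 0 → Fin N) i : ℕ)) : Fin 1 → ℕ) :=
        fun i h => by omega
      rw [if_pos hs]
      have : desF (Fin.cons a (fun i => ((default : Fin 0 → Fin N) i : ℕ)) : Fin 1 → ℕ) = 0 := by
        unfold desF
        rw [Finset.card_eq_zero, Finset.filter_eq_empty_iff]
        intro i; exact i.elim0
      rw [this, pow_zero]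
    unfold TW
    rw [h1]
    simp [Wc]
  | succ n ih =>
    rw [sum_words N n (fun w => TW (Fin.cons a w : Fin (n + 2) → ℕ))]
    rw [Wc, Finset.mul_sum]
    refine Finset.sum_congr rfl fun b _ => ?_
    rw [ih, Finset.mul_sum, Finset.mul_sum]
    refine Finset.sum_congr rfl fun w _ => ?_
    rw [TW_cons, Fin.cons_zero]

lemma Wt_eq (N n : ℕ) : Wt N (n + 1) = ∑ w : Fin (n + 1) → Fin N, TW (fun i => (w i : ℕ)) := by
  rw [sum_words N n TW]
  exact Finset.sum_congr rfl fun b _ => Wc_eq N n b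

noncomputable def wcont {n : ℕ} (w : Fin n → ℕ) : ℕ →₀ ℕ := ∑ i, Finsupp.single (w i) 1

lemma wcont_apply {n : ℕ} (w : Fin n → ℕ) (c : ℕ) :
    wcont w c = Fintype.card {i // w i = c} := by
  rw [Fintype.card_subtype, Finset.card_filter, wcont, Finsupp.finsetSum_apply]
  simp [Finsupp.single_apply]

lemma mem_msPerms {n : ℕ} (u w : Fin n → ℕ) : w ∈ msPerms u ↔ wcont w = wcont u := by
  unfold msPerms
  simp only [Finset.mem_image, Finset.mem_univ, true_and]
  constructor
  · rintro ⟨σ, rfl⟩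
    exact Equiv.sum_comp σ (fun i => Finsupp.single (u i) 1)
  · intro h
    have hc : ∀ c, Nonempty ({i // w i = c} ≃ {i // u i = c}) := fun c => by
      rw [← Fintype.card_eq, ← wcont_apply, ← wcont_apply, h]
    let e := Equiv.ofFiberEquiv (fun c => (hc c).some)
    exact ⟨e, funext fun i => Equiv.ofFiberEquiv_map _ i⟩

lemma coeff_TW {n : ℕ} (w : Fin n → ℕ) (m : ℕ →₀ ℕ) :
    (TW w).coeff m = if wcont w = m then wtp w else 0 := by
  have : (∏ i, MvPolynomial.X (w i) : AA) = MvPolynomial.monomial (wcont w) 1 := by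
    rw [wcont, MvPolynomial.monomial_sum_one]; rfl
  rw [TW, this, mul_comm, MvPolynomial.coeff_C_mul, MvPolynomial.coeff_monomial]
  split_ifs <;> simp

lemma coeff_Wt (N n : ℕ) (u : Fin (n + 1) → ℕ) (hu : ∀ i, u i < N) :
    (Wt N (n + 1)).coeff (wcont u) =
      ∑ w ∈ (msPerms u).filter (fun w => IsSmirnov w), (X : ℤ[X]) ^ desF w := by
  rw [Wt_eq, MvPolynomial.coeff_sum]
  simp only [coeff_TW, ← mem_msPerms]
  rw [← Finset.sum_filter, Finset.sum_filter (s := msPerms u)]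
  refine Finset.sum_bij (fun w _ i => (w i : ℕ)) ?_ ?_ ?_ ?_
  · intro w hw; exact (Finset.mem_filter.1 hw).2
  · intro w _ w' _ h
    funext i; exact Fin.ext (congrFun h i)
  · intro w hw
    have hw' := hw
    unfold msPerms at hw'
    obtain ⟨σ, -, rfl⟩ := Finset.mem_image.1 hw'
    exact ⟨fun i => ⟨u (σ i), hu _⟩, Finset.mem_filter.2 ⟨Finset.mem_univ _, hw⟩, rfl⟩
  · intro w _; rfl

/-- Remark 5.2 of Linusson–Shareshian–Wachs: the descent polynomial
`∑_{w ∈ SW_M} t^{des w}` of the Smirnov words on a multiset `M` of size `n ≥ 1`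
(encoded by its weakly increasing arrangement `u`), written as `∑_{j=0}^{n-1} b_j t^j`,
is palindromic (`b_j = b_{n-1-j}`) and its coefficient sequence is unimodal
(`b_0 ≤ b_1 ≤ ⋯ ≤ b_{⌊(n-1)/2⌋}`). -/
theorem statement_8 (n : ℕ) (hn : 1 ≤ n) (u : Fin n → ℕ)
    (hmono : Monotone u) (hpos : ∀ i, 0 < u i)
    (b : ℕ → ℕ)
    (hb : ∀ j, b j =
      (∑ w ∈ (msPerms u).filter (fun w => IsSmirnov w),
        (X : Polynomial ℕ) ^ desF w).coeff j) :
    (∀ j ≤ n - 1, b j = b (n - 1 - j)) ∧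
      ∀ j : ℕ, j + 1 ≤ (n - 1) / 2 → b j ≤ b (j + 1) := by
  obtain ⟨n, rfl⟩ : ∃ k, n = k + 1 := ⟨n - 1, by omega⟩
  have hu : ∀ i, u i < u (Fin.last n) + 1 := fun i => Nat.lt_succ_of_le (hmono (Fin.le_last i))
  have hS := Wt_KK (u (Fin.last n) + 1) (n + 1) (wcont u)
  rw [coeff_Wt _ _ u hu] at hS
  have hbz : ∀ j : ℕ, cz (∑ w ∈ (msPerms u).filter (fun w => IsSmirnov w), (X : ℤ[X]) ^ desF w) j
      = (b j : ℤ) := by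
    intro j
    rw [cz, if_pos (by omega), hb, Int.toNat_natCast, finsetSum_coeff, finsetSum_coeff]
    push_cast
    refine Finset.sum_congr rfl fun w _ => ?_
    rw [coeff_X_pow, coeff_X_pow]
    split_ifs <;> simp
  constructor
  · intro j hj
    have h := hS.1 j
    rw [show (((n + 1 : ℕ) : ℤ) - 1 - j) = ((n + 1 - 1 - j : ℕ) : ℤ) by omega, hbz, hbz] at h
    exact_mod_cast h.symm
  · intro j hj
    have h := hS.2 j (by omega)
    rw [show ((j : ℤ) + 1) = ((j + 1 : ℕ) : ℤ) by push_cast; rfl, hbz, hbz] at h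
    exact_mod_cast h
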